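/- Let n ≥ 2 be an integer. Then for every real number x, Σ_{k=1}^{n-1} B_k(x) B_{n-k}(x) / (k(n-k)) − 2 Σ_{l=2}^{n} C(n-1, l-1) · B_l B_{n-l}(x) / l² = (2/n) H_{n-1} B_n(x). -/

import Mathlib

open Finset

/-- The `n`-th Bernoulli polynomial evaluated at a real `x`:
`B_n(x) = ∑_{k=0}^n (n choose k) B_k x^(n-k)`, where `B_k` is the `k`-th Bernoulli number
(with the convention `B_1 = -1/2`, i.e. generating function `z e^{xz}/(e^z - 1)`). -/
noncomputable def bernoulliPoly (n : ℕ) (x : ℝ) : ℝ :=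
  ∑ k ∈ Finset.range (n + 1), ((bernoulli k : ℚ) : ℝ) * (n.choose k : ℝ) * x ^ (n - k)

/-- The `n`-th harmonic number `H_n = ∑_{k=1}^n 1/k` as a real number. -/
noncomputable def harm (n : ℕ) : ℝ :=
  ∑ k ∈ Finset.range n, (1 : ℝ) / (k + 1)

open Polynomial in
noncomputable def FF (m : ℕ) : ℚ[X] :=
  (∑ p ∈ antidiagonal m, C (1 / (((p.1 : ℚ) + 1) * ((p.2 : ℚ) + 1))) *
      (Polynomial.bernoulli (p.1 + 1) * Polynomial.bernoulli (p.2 + 1))) -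
  2 * (∑ p ∈ antidiagonal m, C (((m + 1).choose (p.1 + 1) : ℚ) * _root_.bernoulli (p.1 + 2) /
      ((p.1 : ℚ) + 2) ^ 2) * Polynomial.bernoulli p.2) -
  C (2 / ((m : ℚ) + 2) * harmonic (m + 1)) * Polynomial.bernoulli (m + 2)

lemma ber_eval_split (m : ℕ) (x : ℚ) : (Polynomial.bernoulli (m + 2)).eval x =
    x ^ (m + 2) - (m + 2) / 2 * x ^ (m + 1) +
    ∑ i ∈ range (m + 1), ((m + 2).choose (i + 2) : ℚ) * bernoulli (i + 2) * x ^ (m - i) := by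
  simp only [Polynomial.bernoulli, Polynomial.eval_finsetSum, Polynomial.eval_monomial]
  rw [sum_range_succ', sum_range_succ']
  have : ∀ i, m + 2 - (i + 1 + 1) = m - i := by intro i; omega
  simp only [this]
  simp [bernoulli_one]
  have h : ∀ i, ((m + 2).choose (i + 2) : ℚ) * bernoulli (i + 2) * x ^ (m - i) =
    bernoulli (i + 2) * ((m + 2).choose (i + 2) : ℚ) * x ^ (m - i) := by intro i; ring
  simp only [h, add_assoc, one_add_one_eq_two]
  ring

lemma G_eq (x : ℚ) (m : ℕ) :
    ∑ p ∈ antidiagonal m, (Polynomial.bernoulli (p.1 + 1)).eval x * x ^ p.2 / ((p.1 : ℚ) + 1) =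
    harmonic (m + 1) * x ^ (m + 1) - (m + 1) / 2 * x ^ m +
    ∑ i ∈ range m, ((m + 1).choose (i + 2) : ℚ) * bernoulli (i + 2) / (i + 2) * x ^ (m - 1 - i) := by
  induction m with
  | zero => simp [harmonic]
  | succ m ih =>
    rw [Nat.sum_antidiagonal_succ']
    have h1 : ∑ p ∈ antidiagonal m,
        (Polynomial.bernoulli (p.1 + 1)).eval x * x ^ (p.2 + 1) / ((p.1 : ℚ) + 1) =
        x * ∑ p ∈ antidiagonal m,
        (Polynomial.bernoulli (p.1 + 1)).eval x * x ^ p.2 / ((p.1 : ℚ) + 1) := by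
      rw [mul_sum]
      exact sum_congr rfl fun p _ => by ring
    simp only [h1, ih, ber_eval_split, harmonic_succ (m + 1)]
    have h2 : x * ∑ i ∈ range m, ((m + 1).choose (i + 2) : ℚ) * bernoulli (i + 2) / (i + 2) *
        x ^ (m - 1 - i) = ∑ i ∈ range (m + 1), ((m + 1).choose (i + 2) : ℚ) * bernoulli (i + 2) /
        (i + 2) * x ^ (m - i) := by
      rw [sum_range_succ, mul_sum]
      simp only [Nat.choose_eq_zero_of_lt (show m + 1 < m + 2 by omega)]
      simp only [Nat.cast_zero, zero_mul, zero_div, add_zero]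
      refine sum_congr rfl fun i hi => ?_
      have : m - i = (m - 1 - i) + 1 := by have := mem_range.1 hi; omega
      rw [this]; ring
    have h3 : ∑ i ∈ range (m + 1), ((m + 1 + 1).choose (i + 2) : ℚ) * bernoulli (i + 2) /
        (i + 2) * x ^ (m + 1 - 1 - i) = (∑ i ∈ range (m + 1), ((m + 1).choose (i + 2) : ℚ) *
        bernoulli (i + 2) / (i + 2) * x ^ (m - i)) + (∑ i ∈ range (m + 1),
        ((m + 2).choose (i + 2) : ℚ) * bernoulli (i + 2) * x ^ (m - i)) / (m + 2) := by
      rw [sum_div, ← sum_add_distrib]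
      refine sum_congr rfl fun i hi => ?_
      have a1 : ((m + 2).choose (i + 2) : ℚ) = (m + 1).choose (i + 1) + (m + 1).choose (i + 2) := by
        exact_mod_cast Nat.choose_succ_succ (m + 1) (i + 1)
      have a2 : ((m : ℚ) + 2) * (m + 1).choose (i + 1) = (m + 2).choose (i + 2) * (i + 2) := by
        exact_mod_cast Nat.add_one_mul_choose_eq (m + 1) (i + 1)
      have a3 : ((m + 1).choose (i + 2) : ℚ) =
        (m + 2).choose (i + 2) - (m + 2).choose (i + 2) * (i + 2) / (m + 2) := by
        rw [← a2, a1]; field_simp; ring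
      simp only [add_assoc, one_add_one_eq_two, a3, Nat.add_sub_cancel]
      field_simp
      ring
    rw [mul_add, h2, h3]
    push_cast
    have : (m : ℚ) + 1 + 1 ≠ 0 := by positivity
    have : (m : ℚ) + 2 ≠ 0 := by positivity
    field_simp
    ring

lemma FF_periodic (m : ℕ) (x : ℚ) : (FF m).eval (1 + x) = (FF m).eval x := by
  simp only [FF, Polynomial.eval_sub, Polynomial.eval_mul, Polynomial.eval_finsetSum,
    Polynomial.eval_C, Polynomial.eval_ofNat, Polynomial.bernoulli_eval_one_add]
  have h1 : ∑ p ∈ antidiagonal m, 1 / (((p.1 : ℚ) + 1) * ((p.2 : ℚ) + 1)) *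
      (((Polynomial.bernoulli (p.1 + 1)).eval x + ((p.1 + 1 : ℕ) : ℚ) * x ^ (p.1 + 1 - 1)) *
      ((Polynomial.bernoulli (p.2 + 1)).eval x + ((p.2 + 1 : ℕ) : ℚ) * x ^ (p.2 + 1 - 1))) =
      ∑ p ∈ antidiagonal m, 1 / (((p.1 : ℚ) + 1) * ((p.2 : ℚ) + 1)) *
      ((Polynomial.bernoulli (p.1 + 1)).eval x * (Polynomial.bernoulli (p.2 + 1)).eval x) +
      2 * (∑ p ∈ antidiagonal m,
        (Polynomial.bernoulli (p.1 + 1)).eval x * x ^ p.2 / ((p.1 : ℚ) + 1)) +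
      (m + 1) * x ^ m := by
    have e1 : ((m : ℚ) + 1) * x ^ m = ∑ p ∈ antidiagonal m, x ^ p.1 * x ^ p.2 := by
      rw [sum_congr rfl (g := fun _ => x ^ m)]
      · simp
      · intro p hp
        rw [← pow_add, mem_antidiagonal.1 hp]
    have e2 : ∑ p ∈ antidiagonal m,
        (Polynomial.bernoulli (p.1 + 1)).eval x * x ^ p.2 / ((p.1 : ℚ) + 1) =
        ∑ p ∈ antidiagonal m,
        (Polynomial.bernoulli (p.2 + 1)).eval x * x ^ p.1 / ((p.2 : ℚ) + 1) := by
      rw [← Finset.Nat.sum_antidiagonal_swap]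
      rfl
    rw [two_mul]
    nth_rewrite 2 [e2]
    rw [e1, ← sum_add_distrib, ← sum_add_distrib, ← sum_add_distrib]
    refine sum_congr rfl fun p _ => ?_
    push_cast
    field_simp
    ring
  have h2 : ∑ p ∈ antidiagonal m, ((m + 1).choose (p.1 + 1) : ℚ) * bernoulli (p.1 + 2) /
      ((p.1 : ℚ) + 2) ^ 2 * ((Polynomial.bernoulli p.2).eval x + (p.2 : ℚ) * x ^ (p.2 - 1)) =
      ∑ p ∈ antidiagonal m, ((m + 1).choose (p.1 + 1) : ℚ) * bernoulli (p.1 + 2) /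
      ((p.1 : ℚ) + 2) ^ 2 * (Polynomial.bernoulli p.2).eval x +
      ∑ i ∈ range m, ((m + 1).choose (i + 2) : ℚ) * bernoulli (i + 2) / (i + 2) *
        x ^ (m - 1 - i) := by
    have e : ∑ i ∈ range m, ((m + 1).choose (i + 2) : ℚ) * bernoulli (i + 2) / (i + 2) *
        x ^ (m - 1 - i) = ∑ i ∈ range (m + 1), ((m + 1).choose (i + 2) : ℚ) * bernoulli (i + 2) /
        (i + 2) * x ^ (m - 1 - i) := by
      rw [sum_range_succ, Nat.choose_eq_zero_of_lt (show m + 1 < m + 2 by omega)]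
      simp
    rw [e, Nat.sum_antidiagonal_eq_sum_range_succ_mk, Nat.sum_antidiagonal_eq_sum_range_succ_mk,
      ← sum_add_distrib]
    refine sum_congr rfl fun i hi => ?_
    have hi' : i ≤ m := by have := mem_range.1 hi; omega
    have a : ((m + 1).choose (i + 2) : ℚ) * (i + 2) = (m + 1).choose (i + 1) * ((m - i : ℕ) : ℚ) := by
      have := Nat.choose_succ_right_eq (m + 1) (i + 1)
      rw [Nat.add_sub_add_right] at this
      exact_mod_cast this
    have a' : ((m + 1).choose (i + 2) : ℚ) =
      (m + 1).choose (i + 1) * ((m - i : ℕ) : ℚ) / (i + 2) := by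
      rw [← a]; field_simp
    simp only [a', Nat.sub_right_comm m 1 i]
    field_simp
  rw [h1, h2, G_eq]
  push_cast
  field_simp
  ring

lemma FF_deriv (m : ℕ) : Polynomial.derivative (FF (m + 1)) = (m + 2 : ℚ) • FF m := by
  apply Polynomial.funext
  intro x
  simp only [FF, Polynomial.derivative_sub, Polynomial.derivative_sum, Polynomial.derivative_mul,
    Polynomial.derivative_C, Polynomial.derivative_ofNat, zero_mul, zero_add,
    Polynomial.derivative_bernoulli, Nat.add_sub_cancel,
    Polynomial.eval_sub, Polynomial.eval_mul, Polynomial.eval_finsetSum, Polynomial.eval_add,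
    Polynomial.eval_C, Polynomial.eval_ofNat, Polynomial.eval_smul, smul_eq_mul,
    Polynomial.eval_natCast]
  have h1 : ∑ p ∈ antidiagonal (m + 1), 1 / (((p.1 : ℚ) + 1) * ((p.2 : ℚ) + 1)) *
      (((p.1 + 1 : ℕ) : ℚ) * (Polynomial.bernoulli p.1).eval x *
        (Polynomial.bernoulli (p.2 + 1)).eval x +
       (Polynomial.bernoulli (p.1 + 1)).eval x *
        (((p.2 + 1 : ℕ) : ℚ) * (Polynomial.bernoulli p.2).eval x)) =
      (m + 2) * ∑ p ∈ antidiagonal m, 1 / (((p.1 : ℚ) + 1) * ((p.2 : ℚ) + 1)) *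
      ((Polynomial.bernoulli (p.1 + 1)).eval x * (Polynomial.bernoulli (p.2 + 1)).eval x) +
      2 / (m + 2) * (Polynomial.bernoulli (m + 2)).eval x := by
    simp only [mul_add (1 / _ : ℚ), sum_add_distrib]
    rw [Nat.sum_antidiagonal_succ, Nat.sum_antidiagonal_succ', mul_sum]
    have e : ∑ p ∈ antidiagonal m, ((m : ℚ) + 2) * (1 / (((p.1 : ℚ) + 1) * ((p.2 : ℚ) + 1)) *
      ((Polynomial.bernoulli (p.1 + 1)).eval x * (Polynomial.bernoulli (p.2 + 1)).eval x)) =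
      ∑ p ∈ antidiagonal m, ((Polynomial.bernoulli (p.1 + 1)).eval x *
        (Polynomial.bernoulli (p.2 + 1)).eval x / (p.2 + 1)) +
      ∑ p ∈ antidiagonal m, ((Polynomial.bernoulli (p.1 + 1)).eval x *
        (Polynomial.bernoulli (p.2 + 1)).eval x / (p.1 + 1)) := by
      rw [← sum_add_distrib]
      refine sum_congr rfl fun p hp => ?_
      rw [← mem_antidiagonal.1 hp]
      push_cast
      field_simp
      ring
    rw [e]
    have e1 : ∀ p : ℕ × ℕ, 1 / ((((p.1 + 1 : ℕ) : ℚ) + 1) * ((p.2 : ℚ) + 1)) *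
      (((p.1 + 1 + 1 : ℕ) : ℚ) * (Polynomial.bernoulli (p.1 + 1)).eval x *
        (Polynomial.bernoulli (p.2 + 1)).eval x) = ((Polynomial.bernoulli (p.1 + 1)).eval x *
        (Polynomial.bernoulli (p.2 + 1)).eval x / (p.2 + 1)) := by
      intro p
      push_cast
      have : (p.1 : ℚ) + 1 + 1 ≠ 0 := by positivity
      field_simp
    have e2 : ∀ p : ℕ × ℕ, 1 / (((p.1 : ℚ) + 1) * (((p.2 + 1 : ℕ) : ℚ) + 1)) *
      ((Polynomial.bernoulli (p.1 + 1)).eval x *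
        (((p.2 + 1 + 1 : ℕ) : ℚ) * (Polynomial.bernoulli (p.2 + 1)).eval x)) =
        ((Polynomial.bernoulli (p.1 + 1)).eval x *
        (Polynomial.bernoulli (p.2 + 1)).eval x / (p.1 + 1)) := by
      intro p
      push_cast
      have : (p.2 : ℚ) + 1 + 1 ≠ 0 := by positivity
      field_simp
    simp only [e1, e2]
    have : (m : ℚ) + 1 + 1 ≠ 0 := by positivity
    have : (m : ℚ) + 2 ≠ 0 := by positivity
    simp
    field_simp
    ring
  have h2 : ∑ p ∈ antidiagonal (m + 1), ((m + 1 + 1).choose (p.1 + 1) : ℚ) * bernoulli (p.1 + 2) /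
      ((p.1 : ℚ) + 2) ^ 2 * ((p.2 : ℚ) * (Polynomial.bernoulli (p.2 - 1)).eval x) =
      ((m : ℚ) + 2) * ∑ p ∈ antidiagonal m, ((m + 1).choose (p.1 + 1) : ℚ) * bernoulli (p.1 + 2) /
      ((p.1 : ℚ) + 2) ^ 2 * (Polynomial.bernoulli p.2).eval x := by
    rw [Nat.sum_antidiagonal_succ', mul_sum]
    simp only [Nat.cast_zero, zero_mul, mul_zero, zero_add, add_zero]
    refine sum_congr rfl fun p hp => ?_
    have a : ((m + 1).choose (p.1 + 1) : ℚ) * (m + 2) =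
        (m + 1 + 1).choose (p.1 + 1) * ((p.2 + 1 : ℕ) : ℚ) := by
      have := Nat.choose_mul_succ_eq (m + 1) (p.1 + 1)
      have h := mem_antidiagonal.1 hp
      rw [show m + 1 + 1 - (p.1 + 1) = p.2 + 1 by omega] at this
      exact_mod_cast this
    simp only [Nat.add_sub_cancel]
    linear_combination (-(bernoulli (p.1 + 2) /
      ((p.1 : ℚ) + 2) ^ 2 * (Polynomial.bernoulli p.2).eval x)) * a
  rw [h1, h2, harmonic_succ (m + 1), show m + 1 + 2 - 1 = m + 2 from rfl]
  push_cast
  have : (m : ℚ) + 1 + 1 ≠ 0 := by positivity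
  have : (m : ℚ) + 2 ≠ 0 := by positivity
  have : (m : ℚ) + 1 + 2 ≠ 0 := by positivity
  field_simp
  ring

lemma FF_zero (m : ℕ) : FF m = 0 := by
  have hc : FF (m + 1) = Polynomial.C ((FF (m + 1)).eval 0) := by
    apply Polynomial.eq_of_infinite_eval_eq
    refine Set.infinite_of_injective_forall_mem (f := fun k : ℕ => (k : ℚ)) Nat.cast_injective ?_
    intro k
    simp only [Set.mem_ofPred_eq, Polynomial.eval_C]
    induction k with
    | zero => simp
    | succ k ih => rw [← ih, ← FF_periodic (m + 1) k, add_comm]; push_cast; rfl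
  have h := FF_deriv m
  rw [hc, Polynomial.derivative_C] at h
  exact (smul_eq_zero.1 h.symm).resolve_left (by positivity)

lemma poly_eq (n : ℕ) (x : ℝ) : bernoulliPoly n x = Polynomial.aeval x (Polynomial.bernoulli n) := by
  simp [bernoulliPoly, Polynomial.bernoulli, Polynomial.aeval_monomial]

theorem stmt_3 (n : ℕ) (hn : 2 ≤ n) (x : ℝ) :
    (∑ k ∈ Finset.Icc 1 (n - 1),
        bernoulliPoly k x * bernoulliPoly (n - k) x / ((k : ℝ) * ((n : ℝ) - (k : ℝ)))) -
      2 * (∑ l ∈ Finset.Icc 2 n, ((n - 1).choose (l - 1) : ℝ) *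
        ((bernoulli l : ℚ) : ℝ) * bernoulliPoly (n - l) x / (l : ℝ) ^ 2) =
    2 / (n : ℝ) * harm (n - 1) * bernoulliPoly n x := by
  obtain ⟨m, rfl⟩ : ∃ m, n = m + 2 := ⟨n - 2, by omega⟩
  have h := congrArg (Polynomial.aeval x) (FF_zero m)
  simp only [FF, map_sub, map_mul, map_sum, map_zero, Polynomial.aeval_C, ← poly_eq,
    map_ofNat, eq_ratCast] at h
  rw [Nat.sum_antidiagonal_eq_sum_range_succ_mk, Nat.sum_antidiagonal_eq_sum_range_succ_mk] at h
  have hh : harm (m + 2 - 1) = ((harmonic (m + 1) : ℚ) : ℝ) := by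
    simp [harm, harmonic]
  have s1 : ∑ k ∈ Finset.Icc 1 (m + 2 - 1), bernoulliPoly k x * bernoulliPoly (m + 2 - k) x /
      ((k : ℝ) * (((m + 2 : ℕ) : ℝ) - (k : ℝ))) = ∑ k ∈ range (m + 1),
      ((1 / (((k : ℚ) + 1) * (((m - k : ℕ) : ℚ) + 1)) : ℚ) : ℝ) *
      (bernoulliPoly (k + 1) x * bernoulliPoly (m - k + 1) x) := by
    rw [← Finset.Ico_add_one_right_eq_Icc, Finset.sum_Ico_eq_sum_range]
    refine sum_congr (by congr 1) fun k hk => ?_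
    have hk' : k ≤ m := by have := mem_range.1 hk; omega
    rw [show m + 2 - (1 + k) = m - k + 1 by omega, add_comm 1 k]
    push_cast [Nat.cast_sub hk']
    rw [show (m : ℝ) + 2 - (k + 1) = m - k + 1 by ring]
    ring
  have s2 : ∑ l ∈ Finset.Icc 2 (m + 2), ((m + 2 - 1).choose (l - 1) : ℝ) *
        ((bernoulli l : ℚ) : ℝ) * bernoulliPoly (m + 2 - l) x / (l : ℝ) ^ 2 =
      ∑ k ∈ range (m + 1), ((((m + 1).choose (k + 1) : ℚ) * bernoulli (k + 2) /
      ((k : ℚ) + 2) ^ 2 : ℚ) : ℝ) * bernoulliPoly (m - k) x := by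
    rw [← Finset.Ico_add_one_right_eq_Icc, Finset.sum_Ico_eq_sum_range]
    refine sum_congr (by congr 1) fun k hk => ?_
    rw [show m + 2 - (2 + k) = m - k by omega, add_comm 2 k]
    simp only [show m + 2 - 1 = m + 1 from rfl, show k + 2 - 1 = k + 1 from rfl]
    push_cast
    ring
  rw [s1, s2, hh, ← sub_eq_zero, ← h]
  push_cast
  ring
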